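/- Let T be a finite-dimensional Leibniz triple system over a field K of characteristic 0 with universal Leibniz envelope U(T). Let R(T) be the solvable radical of T, Rad(U(T)) the solvable radical of the Leibniz algebra U(T), and K(T) = { w ∈ T ⊗ T : [w, T] = [T, w] = 0 }. Then R(T) = Rad(U(T)) ∩ T and Rad(U(T)) = 𝕀(R(T)) + K(T) = 𝕁(R(T)). -/

import Mathlib

open TensorProduct

noncomputable section

variable {K : Type*} [Field K] [CharZero K]
variable {T : Type*} [AddCommGroup T] [Module K T]

/-- First defining identity of a Leibniz triple system:
`{a{bcd}e} = {{abc}de} − {{acb}de} − {{adb}ce} + {{adc}be}`. -/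
def LTS1 (t : T →ₗ[K] T →ₗ[K] T →ₗ[K] T) : Prop :=
  ∀ a b c d e : T,
    t a (t b c d) e =
      t (t a b c) d e - t (t a c b) d e - t (t a d b) c e + t (t a d c) b e

/-- Second defining identity of a Leibniz triple system:
`{ab{cde}} = {{abc}de} − {{abd}ce} − {{abe}cd} + {{abe}dc}`. -/
def LTS2 (t : T →ₗ[K] T →ₗ[K] T →ₗ[K] T) : Prop :=
  ∀ a b c d e : T,
    t a b (t c d e) =
      t (t a b c) d e - t (t a b d) c e - t (t a b e) c d + t (t a b e) d c

/-- The axioms of a Lie triple system. -/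
def IsLieTS (t : T →ₗ[K] T →ₗ[K] T →ₗ[K] T) : Prop :=
  (∀ a c : T, t a a c = 0) ∧
  (∀ a b c : T, t a b c + t b c a + t c a b = 0) ∧
  (∀ a b c d e : T,
    t a b (t c d e) = t (t a b c) d e + t c (t a b d) e + t c d (t a b e))

/-- The bracket of the universal Leibniz envelope `U(T) = T ⊕ (T ⊗ T)`,
determined by `[a,b] = a⊗b`, `[a⊗b,c] = {abc}`, `[a,b⊗c] = {abc} − {acb}`,
`[a⊗b,c⊗d] = {abc}⊗d − {abd}⊗c`. -/
def bkt (t : T →ₗ[K] T →ₗ[K] T →ₗ[K] T) (x y : T × (T ⊗[K] T)) :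
    T × (T ⊗[K] T) :=
  (TensorProduct.lift t x.2 y.1
      + TensorProduct.lift (t x.1) y.2 - TensorProduct.lift ((t x.1).flip) y.2,
   x.1 ⊗ₜ[K] y.1
      + LinearMap.rTensor T (TensorProduct.lift t x.2) y.2
      - LinearMap.rTensor T (TensorProduct.lift t x.2) (TensorProduct.comm K T T y.2))

/-- The induced bracket on the subalgebra `T ⊗ T` of `U(T)`. -/
def bktT (t : T →ₗ[K] T →ₗ[K] T →ₗ[K] T) (w w' : T ⊗[K] T) : T ⊗[K] T :=
  LinearMap.rTensor T (TensorProduct.lift t w) w'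
    - LinearMap.rTensor T (TensorProduct.lift t w) (TensorProduct.comm K T T w')

/-- `{ABC}`: the span of all products `{abc}` with `a ∈ A`, `b ∈ B`, `c ∈ C`. -/
def tspan (t : T →ₗ[K] T →ₗ[K] T →ₗ[K] T) (A B C : Submodule K T) : Submodule K T :=
  Submodule.span K {x | ∃ a ∈ A, ∃ b ∈ B, ∃ c ∈ C, x = t a b c}

/-- `I` is an ideal of the Leibniz triple system `(T, t)`. -/
def IsIdealT (t : T →ₗ[K] T →ₗ[K] T →ₗ[K] T) (I : Submodule K T) : Prop :=
  ∀ x ∈ I, ∀ a b : T, t x a b ∈ I ∧ t a x b ∈ I ∧ t a b x ∈ I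

/-- `i(I) = I ⊗ T + T ⊗ I` as a subspace of `T ⊗ T`. -/
def iI (I : Submodule K T) : Submodule K (T ⊗[K] T) :=
  Submodule.span K
    {z | (∃ x ∈ I, ∃ a : T, z = x ⊗ₜ[K] a) ∨ (∃ x ∈ I, ∃ a : T, z = a ⊗ₜ[K] x)}

/-- `j(I) = {w ∈ T⊗T | [w, T] + [T, w] ⊆ I}`. -/
def jI (t : T →ₗ[K] T →ₗ[K] T →ₗ[K] T) (I : Submodule K T) : Submodule K (T ⊗[K] T) :=
  ⨅ a : T,
    Submodule.comap ((TensorProduct.lift t).flip a) I ⊓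
      Submodule.comap (TensorProduct.lift (t a) - TensorProduct.lift ((t a).flip)) I

/-- `𝕀(I) = I + i(I)` as a subspace of `U(T)`. -/
def IU (I : Submodule K T) : Submodule K (T × (T ⊗[K] T)) := I.prod (iI I)

/-- `𝕁(I) = I + j(I)` as a subspace of `U(T)`. -/
def JU (t : T →ₗ[K] T →ₗ[K] T →ₗ[K] T) (I : Submodule K T) :
    Submodule K (T × (T ⊗[K] T)) := I.prod (jI t I)

/-- `V` is an ideal of the Leibniz algebra `T ⊗ T`. -/
def IsIdealTT (t : T →ₗ[K] T →ₗ[K] T →ₗ[K] T) (V : Submodule K (T ⊗[K] T)) : Prop :=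
  ∀ v ∈ V, ∀ w : T ⊗[K] T, bktT t v w ∈ V ∧ bktT t w v ∈ V

/-- `V` is an ideal of the Leibniz algebra `U(T)`. -/
def IsIdealU (t : T →ₗ[K] T →ₗ[K] T →ₗ[K] T) (V : Submodule K (T × (T ⊗[K] T))) : Prop :=
  ∀ v ∈ V, ∀ x : T × (T ⊗[K] T), bkt t v x ∈ V ∧ bkt t x v ∈ V

/-- The derived series of `I` relative to an ambient subsystem `S`:
`I⁰ = I`, `Iⁿ⁺¹ = {S Iⁿ Iⁿ} + {Iⁿ S Iⁿ} + {Iⁿ Iⁿ S}`. -/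
def derRel (t : T →ₗ[K] T →ₗ[K] T →ₗ[K] T) (S I : Submodule K T) : ℕ → Submodule K T
  | 0 => I
  | n + 1 =>
      tspan t S (derRel t S I n) (derRel t S I n) ⊔
        tspan t (derRel t S I n) S (derRel t S I n) ⊔
          tspan t (derRel t S I n) (derRel t S I n) S

/-- The derived series `I^[n]` of an ideal `I` of `T`:
`I^[0] = I`, `I^[n+1] = {T I^[n] I^[n]} + {I^[n] T I^[n]} + {I^[n] I^[n] T}`. -/
def derT (t : T →ₗ[K] T →ₗ[K] T →ₗ[K] T) (I : Submodule K T) : ℕ → Submodule K T :=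
  derRel t ⊤ I

/-- `I` is a solvable ideal of the Leibniz triple system `T`. -/
def IsSolvT (t : T →ₗ[K] T →ₗ[K] T →ₗ[K] T) (I : Submodule K T) : Prop :=
  ∃ k, derT t I k = ⊥

/-- The span of all brackets `[x, y]`, `x ∈ A`, `y ∈ B`, in `U(T)`. -/
def bspan (t : T →ₗ[K] T →ₗ[K] T →ₗ[K] T) (A B : Submodule K (T × (T ⊗[K] T))) :
    Submodule K (T × (T ⊗[K] T)) :=
  Submodule.span K {z | ∃ x ∈ A, ∃ y ∈ B, z = bkt t x y}

/-- The derived series of a subspace `V` of the Leibniz algebra `U(T)`. -/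
def derU (t : T →ₗ[K] T →ₗ[K] T →ₗ[K] T) (V : Submodule K (T × (T ⊗[K] T))) :
    ℕ → Submodule K (T × (T ⊗[K] T))
  | 0 => V
  | n + 1 => bspan t (derU t V n) (derU t V n)

/-- `V` is a solvable subspace of the Leibniz algebra `U(T)`. -/
def IsSolvU (t : T →ₗ[K] T →ₗ[K] T →ₗ[K] T) (V : Submodule K (T × (T ⊗[K] T))) : Prop :=
  ∃ k, derU t V k = ⊥

/-- The solvable radical `R(T)`: the sum of all solvable ideals of `T`. -/
def radT (t : T →ₗ[K] T →ₗ[K] T →ₗ[K] T) : Submodule K T :=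
  sSup {S : Submodule K T | IsIdealT t S ∧ IsSolvT t S}

/-- The solvable radical `Rad(U(T))`: the sum of all solvable ideals of `U(T)`. -/
def radU (t : T →ₗ[K] T →ₗ[K] T →ₗ[K] T) : Submodule K (T × (T ⊗[K] T)) :=
  sSup {V : Submodule K (T × (T ⊗[K] T)) | IsIdealU t V ∧ IsSolvU t V}

/-- `Ker(T)`: the span of all `{abc} − {acb} + {bca}`. -/
def kerT (t : T →ₗ[K] T →ₗ[K] T →ₗ[K] T) : Submodule K T :=
  Submodule.span K {x | ∃ a b c : T, x = t a b c - t a c b + t b c a}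

/-- `Ker(U(T))`: the span of all `[x, x]`, `x ∈ U(T)`. -/
def kerU (t : T →ₗ[K] T →ₗ[K] T →ₗ[K] T) : Submodule K (T × (T ⊗[K] T)) :=
  Submodule.span K {z | ∃ x : T × (T ⊗[K] T), z = bkt t x x}

/-- The central lower sequence of an ideal `I` of `T`: `I⁰ = I`,
`Iᵐ⁺¹ = {Iᵐ I T} + {Iᵐ T I} + {I Iᵐ T} + {I T Iᵐ} + {T I Iᵐ} + {T Iᵐ I}`. -/
def clsT (t : T →ₗ[K] T →ₗ[K] T →ₗ[K] T) (I : Submodule K T) : ℕ → Submodule K T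
  | 0 => I
  | m + 1 =>
      tspan t (clsT t I m) I ⊤ ⊔ tspan t (clsT t I m) ⊤ I ⊔
        tspan t I (clsT t I m) ⊤ ⊔ tspan t I ⊤ (clsT t I m) ⊔
          tspan t ⊤ I (clsT t I m) ⊔ tspan t ⊤ (clsT t I m) I

/-- `I` is a nilpotent ideal of the Leibniz triple system `T`. -/
def IsNilT (t : T →ₗ[K] T →ₗ[K] T →ₗ[K] T) (I : Submodule K T) : Prop :=
  ∃ n, clsT t I n = ⊥

/-- The lower central series of a subspace `V` of the Leibniz algebra `U(T)`:
`V⁰ = V`, `Vᵐ⁺¹ = [Vᵐ, V]`. -/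
def clsU (t : T →ₗ[K] T →ₗ[K] T →ₗ[K] T) (V : Submodule K (T × (T ⊗[K] T))) :
    ℕ → Submodule K (T × (T ⊗[K] T))
  | 0 => V
  | m + 1 => bspan t (clsU t V m) V

/-- `V` is a nilpotent subspace of the Leibniz algebra `U(T)`. -/
def IsNilU (t : T →ₗ[K] T →ₗ[K] T →ₗ[K] T) (V : Submodule K (T × (T ⊗[K] T))) : Prop :=
  ∃ n, clsU t V n = ⊥

/-- `Tⁿ`: the lower central series of `T`, `T⁰ = T`,
`Tⁿ⁺¹ = {Tⁿ T T} + {T Tⁿ T} + {T T Tⁿ}`. -/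
def lcsT (t : T →ₗ[K] T →ₗ[K] T →ₗ[K] T) : ℕ → Submodule K T
  | 0 => ⊤
  | n + 1 => tspan t (lcsT t n) ⊤ ⊤ ⊔ tspan t ⊤ (lcsT t n) ⊤ ⊔ tspan t ⊤ ⊤ (lcsT t n)

/-- `T⁽ⁿ⁾`: `T⁽⁰⁾ = T`, `T⁽ⁿ⁺¹⁾ = {T⁽ⁿ⁾ T T}`. -/
def powT (t : T →ₗ[K] T →ₗ[K] T →ₗ[K] T) : ℕ → Submodule K T
  | 0 => ⊤
  | n + 1 => tspan t (powT t n) ⊤ ⊤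

set_option linter.unusedSectionVars false

section Operators

variable (t : T →ₗ[K] T →ₗ[K] T →ₗ[K] T)

/-- The right action `a ↦ [a, w]` of `T ⊗ T` on `T`. -/
def rightOp : T ⊗[K] T →ₗ[K] T →ₗ[K] T :=
  LinearMap.mk₂ K (fun w a => lift (t a) w - lift ((t a).flip) w)
    (by
      intro w v a
      simp only [map_add]
      abel)
    (by
      intro c w a
      simp only [map_smul, smul_sub])
    (by
      intro w a b
      induction w with
      | zero => simp
      | tmul x y => simp only [lift.tmul, map_add, LinearMap.add_apply, LinearMap.flip_apply]; abel
      | add v w hv hw =>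
        simp only [map_add] at hv hw ⊢
        rw [add_sub_add_comm, hv, hw]
        abel)
    (by
      intro c w a
      induction w with
      | zero => simp
      | tmul x y =>
        simp only [lift.tmul, map_smul, LinearMap.smul_apply, LinearMap.flip_apply, smul_sub]
      | add v w hv hw =>
        simp only [map_add] at hv hw ⊢
        rw [add_sub_add_comm, hv, hw, ← smul_add]
        abel_nf)

lemma rightOp_apply (w : T ⊗[K] T) (a : T) :
    rightOp t w a = lift (t a) w - lift ((t a).flip) w := rfl

@[simp] lemma rightOp_tmul (a b c : T) : rightOp t (b ⊗ₜ c) a = t a b c - t a c b := rfl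

/-- `bktT` as a bilinear map. -/
def bktTL : T ⊗[K] T →ₗ[K] T ⊗[K] T →ₗ[K] T ⊗[K] T :=
  LinearMap.mk₂ K (bktT t)
    (by intro a b c; simp only [bktT, map_add, LinearMap.rTensor_add, LinearMap.add_apply]; abel)
    (by
      intro a b c
      simp only [bktT, map_smul, LinearMap.rTensor_smul, LinearMap.smul_apply, smul_sub])
    (by intro a b c; simp only [bktT, map_add]; abel)
    (by intro a b c; simp only [bktT, map_smul, smul_sub])

@[simp] lemma bktTL_tmul (w : T ⊗[K] T) (c d : T) :
    bktTL t w (c ⊗ₜ d) = lift t w c ⊗ₜ d - lift t w d ⊗ₜ c := rfl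

lemma bkt_mk (a b : T) (w v : T ⊗[K] T) :
    bkt t (a, w) (b, v) = (lift t w b + rightOp t v a, a ⊗ₜ b + bktTL t w v) := by
  ext
  · simp only [bkt, rightOp_apply]; abel
  · change _ = a ⊗ₜ b + bktT t w v
    simp only [bkt, bktT]; abel

/-- The bracket of `U(T)` as a bilinear map. -/
def bktL : (T × (T ⊗[K] T)) →ₗ[K] (T × (T ⊗[K] T)) →ₗ[K] (T × (T ⊗[K] T)) :=
  LinearMap.mk₂ K (bkt t)
    (by
      rintro ⟨a, w⟩ ⟨b, v⟩ ⟨c, u⟩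
      simp only [bkt_mk, Prod.mk_add_mk, map_add, LinearMap.add_apply, add_tmul]
      congr 1 <;> abel)
    (by
      rintro r ⟨a, w⟩ ⟨b, v⟩
      simp only [bkt_mk, Prod.smul_mk, map_smul, LinearMap.smul_apply, smul_tmul', smul_add])
    (by
      rintro ⟨a, w⟩ ⟨b, v⟩ ⟨c, u⟩
      simp only [bkt_mk, Prod.mk_add_mk, map_add, LinearMap.add_apply, tmul_add]
      congr 1 <;> abel)
    (by
      rintro r ⟨a, w⟩ ⟨b, v⟩
      simp only [bkt_mk, Prod.smul_mk, map_smul, LinearMap.smul_apply, tmul_smul, smul_add])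

lemma bktL_apply (x y : T × (T ⊗[K] T)) : bktL t x y = bkt t x y := rfl

lemma mem_jI {I : Submodule K T} {w : T ⊗[K] T} :
    w ∈ jI t I ↔ ∀ a, lift t w a ∈ I ∧ rightOp t w a ∈ I := by
  simp only [jI, Submodule.mem_iInf, Submodule.mem_inf, Submodule.mem_comap]
  rfl

end Operators

section Identities

variable {t : T →ₗ[K] T →ₗ[K] T →ₗ[K] T}

lemma lift_bktTL (h2 : LTS2 t) (w v : T ⊗[K] T) (e : T) :
    lift t (bktTL t w v) e = lift t w (lift t v e) + rightOp t v (lift t w e) := by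
  induction v with
  | zero => simp
  | add x y hx hy => simp only [map_add, LinearMap.add_apply, hx, hy]; abel
  | tmul c d =>
    induction w with
    | zero => simp
    | add x y hx hy => simp only [map_add, LinearMap.add_apply, hx, hy]; abel
    | tmul a b =>
      simp only [bktTL_tmul, map_sub, LinearMap.sub_apply, lift.tmul, rightOp_tmul, h2 a b c d e]
      abel

lemma lift_symm_eq_zero (h2 : LTS2 t) (w v : T ⊗[K] T) (a : T) :
    lift t w (lift t v a + rightOp t v a) = 0 := by
  induction v with
  | zero => simp
  | add x y hx hy =>
    simp only [map_add, LinearMap.add_apply] at hx hy ⊢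
    rw [add_add_add_comm, hx, hy, add_zero]
  | tmul c d =>
    induction w with
    | zero => simp
    | add x y hx hy => rw [map_add (lift t), LinearMap.add_apply, hx, hy, add_zero]
    | tmul x y =>
      simp only [map_add, map_sub, lift.tmul, rightOp_tmul, h2 x y]
      abel

lemma rightOp_bktTL (h1 : LTS1 t) (h2 : LTS2 t) (v w : T ⊗[K] T) (a : T) :
    rightOp t (bktTL t v w) a =
      rightOp t w (rightOp t v a) - rightOp t v (rightOp t w a) := by
  induction w with
  | zero => simp
  | add x y hx hy => simp only [map_add, LinearMap.add_apply, hx, hy]; abel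
  | tmul c d =>
    induction v with
    | zero => simp
    | add x y hx hy =>
      simp only [map_add, LinearMap.add_apply, hx, hy]; abel
    | tmul x y =>
      simp only [bktTL_tmul, map_sub, LinearMap.sub_apply, lift.tmul, rightOp_tmul, h2 a, h1 a]
      abel

lemma tmul_rightOp_sub_mem (h1 : LTS1 t) (h2 : LTS2 t) (a b : T) (w : T ⊗[K] T) :
    a ⊗ₜ rightOp t w b - bktTL t (a ⊗ₜ b) w + rightOp t w a ⊗ₜ b ∈ jI t ⊥ := by
  induction w with
  | zero => simp
  | add x y hx hy =>
    convert! add_mem hx hy using 1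
    simp only [map_add, LinearMap.add_apply, tmul_add, add_tmul]
    abel
  | tmul c d =>
    rw [mem_jI]
    intro e
    simp only [Submodule.mem_bot]
    constructor
    · simp only [bktTL_tmul, map_sub, map_add, LinearMap.sub_apply, LinearMap.add_apply, lift.tmul,
        rightOp_tmul, h1 a]
      abel
    · simp only [bktTL_tmul, map_sub, map_add, LinearMap.sub_apply, LinearMap.add_apply, lift.tmul,
        rightOp_tmul, h1 e, h2 e]
      abel

lemma tmul_symm_mem (h1 : LTS1 t) (h2 : LTS2 t) (a b : T) (w : T ⊗[K] T) :
    a ⊗ₜ (lift t w b + rightOp t w b) ∈ jI t ⊥ := by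
  induction w with
  | zero => simp
  | add x y hx hy =>
    convert! add_mem hx hy using 1
    simp only [map_add, LinearMap.add_apply, tmul_add]
    abel
  | tmul c d =>
    rw [mem_jI]
    intro e
    simp only [Submodule.mem_bot, rightOp_tmul, lift.tmul, map_add, map_sub, LinearMap.add_apply,
      LinearMap.sub_apply, h1 a, h1 e, h2 e]
    constructor <;> abel

/-- `K(T)` as a subspace of `U(T)`. -/
abbrev annU (t : T →ₗ[K] T →ₗ[K] T →ₗ[K] T) : Submodule K (T × (T ⊗[K] T)) :=
  (⊥ : Submodule K T).prod (jI t ⊥)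

lemma bkt_leibniz_mem (h1 : LTS1 t) (h2 : LTS2 t) (x y z : T × (T ⊗[K] T)) :
    bkt t x (bkt t y z) - bkt t (bkt t x y) z + bkt t (bkt t x z) y ∈ annU t := by
  obtain ⟨a, u⟩ := x
  obtain ⟨b, v⟩ := y
  obtain ⟨c, w⟩ := z
  have s₁ (u v : T ⊗[K] T) (a : T) : lift t u (rightOp t v a) = - lift t u (lift t v a) := by
    rw [eq_neg_iff_add_eq_zero, ← map_add, add_comm, lift_symm_eq_zero h2]
  simp only [bkt_mk, Prod.mk_sub_mk, Prod.mk_add_mk, Submodule.mem_prod, Submodule.mem_bot]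
  constructor
  · simp only [map_add, LinearMap.add_apply, lift_bktTL h2, rightOp_bktTL h1 h2, lift.tmul,
      rightOp_tmul, s₁]
    abel
  · have e₁ : a ⊗ₜ (lift t v c + rightOp t w b) + bktTL t u (b ⊗ₜ c + bktTL t v w)
        - ((lift t u b + rightOp t v a) ⊗ₜ c + bktTL t (a ⊗ₜ b + bktTL t u v) w)
        + ((lift t u c + rightOp t w a) ⊗ₜ b + bktTL t (a ⊗ₜ c + bktTL t u w) v)
        = (a ⊗ₜ rightOp t w b - bktTL t (a ⊗ₜ b) w + rightOp t w a ⊗ₜ b)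
          - (a ⊗ₜ rightOp t v c - bktTL t (a ⊗ₜ c) v + rightOp t v a ⊗ₜ c)
          + a ⊗ₜ (lift t v c + rightOp t v c)
          + (bktTL t u (bktTL t v w) - bktTL t (bktTL t u v) w + bktTL t (bktTL t u w) v) := by
      simp only [map_add, LinearMap.add_apply, tmul_add, add_tmul, bktTL_tmul]
      abel
    rw [e₁]
    refine add_mem (add_mem (sub_mem (tmul_rightOp_sub_mem h1 h2 a b w)
      (tmul_rightOp_sub_mem h1 h2 a c v)) (tmul_symm_mem h1 h2 a c v)) ?_
    rw [mem_jI]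
    intro e
    simp only [map_add, map_sub, LinearMap.add_apply, LinearMap.sub_apply, lift_bktTL h2,
      rightOp_bktTL h1 h2, s₁, Submodule.mem_bot]
    constructor <;> abel

lemma bktTL_eq_zero {w : T ⊗[K] T} (hw : w ∈ jI t ⊥) (v : T ⊗[K] T) : bktTL t w v = 0 := by
  have h0 : lift t w = 0 := LinearMap.ext fun a => (((mem_jI t).1 hw) a).1
  induction v with
  | zero => simp
  | add x y hx hy => rw [map_add, hx, hy, add_zero]
  | tmul c d => simp [h0]

lemma bkt_annU_left {x : T × (T ⊗[K] T)} (hx : x ∈ annU t) (y : T × (T ⊗[K] T)) :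
    bkt t x y = 0 := by
  obtain ⟨a, w⟩ := x
  obtain ⟨b, v⟩ := y
  obtain ⟨rfl : a = 0, hw⟩ := hx
  have h0 : lift t w b = 0 := (((mem_jI t).1 hw) b).1
  simp [bkt_mk, bktTL_eq_zero hw, h0]

lemma bkt_annU_right (h1 : LTS1 t) (h2 : LTS2 t) {y : T × (T ⊗[K] T)} (hy : y ∈ annU t)
    (x : T × (T ⊗[K] T)) : bkt t x y ∈ annU t := by
  obtain ⟨a, u⟩ := x
  obtain ⟨b, w⟩ := y
  obtain ⟨rfl : b = 0, hw⟩ := hy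
  have hl (b : T) : lift t w b = 0 := (((mem_jI t).1 hw) b).1
  have hr (b : T) : rightOp t w b = 0 := (((mem_jI t).1 hw) b).2
  simp [bkt_mk, hr, mem_jI, lift_bktTL h2, rightOp_bktTL h1 h2, hl]

lemma isIdealU_annU (h1 : LTS1 t) (h2 : LTS2 t) : IsIdealU t (annU t) := fun _ hv x =>
  ⟨by rw [bkt_annU_left hv]; exact zero_mem _, bkt_annU_right h1 h2 hv x⟩

end Identities

section Solvability

variable {t : T →ₗ[K] T →ₗ[K] T →ₗ[K] T}

lemma bspan_le {A B C : Submodule K (T × (T ⊗[K] T))} :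
    bspan t A B ≤ C ↔ ∀ x ∈ A, ∀ y ∈ B, bkt t x y ∈ C := by
  rw [bspan, Submodule.span_le]
  exact ⟨fun h x hx y hy => h ⟨x, hx, y, hy, rfl⟩,
    by rintro h _ ⟨x, hx, y, hy, rfl⟩; exact h x hx y hy⟩

lemma mem_bspan {A B : Submodule K (T × (T ⊗[K] T))} {x y : T × (T ⊗[K] T)} (hx : x ∈ A)
    (hy : y ∈ B) : bkt t x y ∈ bspan t A B :=
  Submodule.subset_span ⟨x, hx, y, hy, rfl⟩

lemma bspan_mono {A A' B B' : Submodule K (T × (T ⊗[K] T))} (hA : A ≤ A') (hB : B ≤ B') :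
    bspan t A B ≤ bspan t A' B' :=
  bspan_le.2 fun _ hx _ hy => mem_bspan (hA hx) (hB hy)

lemma tspan_le {A B C D : Submodule K T} :
    tspan t A B C ≤ D ↔ ∀ a ∈ A, ∀ b ∈ B, ∀ c ∈ C, t a b c ∈ D := by
  rw [tspan, Submodule.span_le]
  exact ⟨fun h a ha b hb c hc => h ⟨a, ha, b, hb, c, hc, rfl⟩,
    by rintro h _ ⟨a, ha, b, hb, c, hc, rfl⟩; exact h a ha b hb c hc⟩

lemma bkt_add_left (x y z : T × (T ⊗[K] T)) : bkt t (x + y) z = bkt t x z + bkt t y z :=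
  LinearMap.map_add₂ (bktL t) x y z

lemma bkt_add_right (x y z : T × (T ⊗[K] T)) : bkt t x (y + z) = bkt t x y + bkt t x z :=
  map_add (bktL t x) y z

lemma IsIdealU.sup {V W : Submodule K (T × (T ⊗[K] T))} (hV : IsIdealU t V) (hW : IsIdealU t W) :
    IsIdealU t (V ⊔ W) := by
  intro v hv x
  obtain ⟨v', hv', w, hw, rfl⟩ := Submodule.mem_sup.1 hv
  rw [bkt_add_left, bkt_add_right]
  exact ⟨Submodule.add_mem_sup (hV v' hv' x).1 (hW w hw x).1,
    Submodule.add_mem_sup (hV v' hv' x).2 (hW w hw x).2⟩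

lemma isIdealU_iff_le {V : Submodule K (T × (T ⊗[K] T))} :
    IsIdealU t V ↔ bspan t V ⊤ ≤ V ∧ bspan t ⊤ V ≤ V := by
  simp only [bspan_le, IsIdealU]
  exact ⟨fun h => ⟨fun v hv x _ => (h v hv x).1, fun x _ v hv => (h v hv x).2⟩,
    fun h v hv x => ⟨h.1 v hv x trivial, h.2 x trivial v hv⟩⟩

lemma derU_mono {V W : Submodule K (T × (T ⊗[K] T))} (h : V ≤ W) (n : ℕ) :
    derU t V n ≤ derU t W n := by
  induction n with
  | zero => exact h
  | succ n ih => exact bspan_mono ih ih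

lemma derU_add (V : Submodule K (T × (T ⊗[K] T))) (m n : ℕ) :
    derU t V (m + n) = derU t (derU t V m) n := by
  induction n with
  | zero => rfl
  | succ n ih => rw [← add_assoc, derU, derU, ih]

lemma IsSolvU.of_derU_le {V W : Submodule K (T × (T ⊗[K] T))} (hW : IsSolvU t W) (m : ℕ)
    (h : derU t V m ≤ W) : IsSolvU t V := by
  obtain ⟨k, hk⟩ := hW
  refine ⟨m + k, ?_⟩
  rw [derU_add, eq_bot_iff, ← hk]
  exact derU_mono h k

lemma derU_sup_le {V W : Submodule K (T × (T ⊗[K] T))} (hW : IsIdealU t W) (n : ℕ) :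
    derU t (V ⊔ W) n ≤ derU t V n ⊔ W := by
  induction n with
  | zero => exact le_rfl
  | succ n ih =>
    refine bspan_le.2 fun x hx y hy => ?_
    obtain ⟨v, hv, w, hw, rfl⟩ := Submodule.mem_sup.1 (ih hx)
    obtain ⟨v', hv', w', hw', rfl⟩ := Submodule.mem_sup.1 (ih hy)
    rw [bkt_add_left, bkt_add_right, add_assoc]
    exact Submodule.add_mem_sup (mem_bspan hv hv') (add_mem (hW _ hw' _).2 (hW _ hw _).1)

lemma IsSolvU.sup {V W : Submodule K (T × (T ⊗[K] T))} (hV : IsSolvU t V) (hW : IsSolvU t W)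
    (hW' : IsIdealU t W) : IsSolvU t (V ⊔ W) := by
  obtain ⟨k, hk⟩ := hV
  refine hW.of_derU_le k ((derU_sup_le hW' k).trans ?_)
  rw [hk, bot_sup_eq]

lemma bkt_zero_left (x : T × (T ⊗[K] T)) : bkt t 0 x = 0 := LinearMap.map_zero₂ (bktL t) x

lemma bkt_zero_right (x : T × (T ⊗[K] T)) : bkt t x 0 = 0 := map_zero (bktL t x)

lemma isSolvU_annU : IsSolvU t (annU t) := by
  refine ⟨1, eq_bot_iff.2 (bspan_le.2 fun x hx y _ => ?_)⟩
  rw [bkt_annU_left hx]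
  exact zero_mem _

lemma radU_mem [FiniteDimensional K T] :
    IsIdealU t (radU t) ∧ IsSolvU t (radU t) := by
  have : IsIdealU t (⊥ : Submodule K (T × (T ⊗[K] T))) := by
    rintro v (rfl : v = 0) x
    rw [bkt_zero_left, bkt_zero_right]
    exact ⟨zero_mem _, zero_mem _⟩
  exact CompleteLattice.WellFoundedGT.isSupClosedCompact _
    (inferInstance : WellFoundedGT (Submodule K (T × (T ⊗[K] T))))
    {V | IsIdealU t V ∧ IsSolvU t V} ⟨⊥, this, 0, rfl⟩
    fun V hV W hW => ⟨hV.1.sup hW.1, hV.2.sup hW.2 hW.1⟩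

lemma le_radU {V : Submodule K (T × (T ⊗[K] T))} (hV : IsIdealU t V) (hs : IsSolvU t V) :
    V ≤ radU t := le_sSup ⟨hV, hs⟩

lemma le_radT {I : Submodule K T} (hI : IsIdealT t I) (hs : IsSolvT t I) :
    I ≤ radT t := le_sSup ⟨hI, hs⟩

/-- Modulo `K(T)`, the derived subspace of an ideal of `U(T)` is an ideal. -/
lemma isIdealU_bspan_sup_annU (h1 : LTS1 t) (h2 : LTS2 t) {A : Submodule K (T × (T ⊗[K] T))}
    (hA : IsIdealU t (A ⊔ annU t)) : IsIdealU t (bspan t A A ⊔ annU t) := by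
  have key : ∀ a ∈ A, ∀ y ∈ A ⊔ annU t,
      bkt t a y ∈ bspan t A A ⊔ annU t ∧ bkt t y a ∈ bspan t A A ⊔ annU t := by
    intro a ha y hy
    obtain ⟨b, hb, k, hk, rfl⟩ := Submodule.mem_sup.1 hy
    rw [bkt_add_left, bkt_add_right, bkt_annU_left hk, add_zero]
    exact ⟨Submodule.add_mem_sup (mem_bspan ha hb) (bkt_annU_right h1 h2 hk a),
      Submodule.mem_sup_left (mem_bspan hb ha)⟩
  have hleib := fun x y z => Submodule.mem_sup_right (S := bspan t A A)
    (bkt_leibniz_mem h1 h2 x y z)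
  refine isIdealU_iff_le.2 ⟨bspan_le.2 fun v hv x _ => ?_, bspan_le.2 fun x _ v hv => ?_⟩
  · suffices h : bspan t A A ⊔ annU t ≤
        (bspan t A A ⊔ annU t).comap ((bktL t).flip x) from h hv
    refine sup_le (bspan_le.2 fun a ha b hb => ?_) fun k hk => ?_
    · have := hleib a b x
      have e : bkt t (bkt t a b) x =
          bkt t a (bkt t b x) + bkt t (bkt t a x) b
            - (bkt t a (bkt t b x) - bkt t (bkt t a b) x + bkt t (bkt t a x) b) := by abel
      change bkt t (bkt t a b) x ∈ bspan t A A ⊔ annU t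
      rw [e]
      exact sub_mem (add_mem (key a ha _ (hA b (Submodule.mem_sup_left hb) x).1).1
        (key b hb _ (hA a (Submodule.mem_sup_left ha) x).1).2) this
    · change bkt t k x ∈ bspan t A A ⊔ annU t
      rw [bkt_annU_left hk]
      exact zero_mem _
  · suffices h : bspan t A A ⊔ annU t ≤
        (bspan t A A ⊔ annU t).comap (bktL t x) from h hv
    refine sup_le (bspan_le.2 fun a ha b hb => ?_) fun k hk => ?_
    · have := hleib x a b
      have e : bkt t x (bkt t a b) =
          (bkt t x (bkt t a b) - bkt t (bkt t x a) b + bkt t (bkt t x b) a)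
            + (bkt t (bkt t x a) b - bkt t (bkt t x b) a) := by abel
      change bkt t x (bkt t a b) ∈ bspan t A A ⊔ annU t
      rw [e]
      exact add_mem this (sub_mem (key b hb _ (hA a (Submodule.mem_sup_left ha) x).2).2
        (key a ha _ (hA b (Submodule.mem_sup_left hb) x).2).2)
    · exact Submodule.mem_sup_right (bkt_annU_right h1 h2 hk x)

lemma isIdealU_derU_sup_annU (h1 : LTS1 t) (h2 : LTS2 t) {V : Submodule K (T × (T ⊗[K] T))}
    (hV : IsIdealU t V) (n : ℕ) : IsIdealU t (derU t V n ⊔ annU t) := by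
  induction n with
  | zero => exact hV.sup (isIdealU_annU h1 h2)
  | succ n ih => exact isIdealU_bspan_sup_annU h1 h2 ih

lemma bkt_bkt_inl (a b c : T) :
    bkt t (bkt t (a, 0) (b, 0)) (c, 0) = (t a b c, 0) := by
  simp [bkt_mk]

lemma IsIdealU.comap_inl {V : Submodule K (T × (T ⊗[K] T))} (hV : IsIdealU t V) :
    IsIdealT t (V.comap (LinearMap.inl K T (T ⊗[K] T))) := by
  intro x hx a b
  simp only [Submodule.mem_comap, LinearMap.inl_apply] at hx ⊢
  simp only [← bkt_bkt_inl]
  exact ⟨(hV _ (hV _ hx _).1 _).1, (hV _ (hV _ hx _).2 _).1, (hV _ hx _).2⟩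

lemma derT_comap_inl_le (h1 : LTS1 t) (h2 : LTS2 t) {V : Submodule K (T × (T ⊗[K] T))}
    (hV : IsIdealU t V) (n : ℕ) :
    derT t (V.comap (LinearMap.inl K T (T ⊗[K] T))) n ≤
      (derU t V n ⊔ annU t).comap (LinearMap.inl K T (T ⊗[K] T)) := by
  induction n with
  | zero => exact Submodule.comap_mono le_sup_left
  | succ n ih =>
    have hn := isIdealU_derU_sup_annU h1 h2 hV n
    have hn' := isIdealU_derU_sup_annU h1 h2 hV (n + 1)
    have key : ∀ x ∈ derU t V n ⊔ annU t, ∀ y ∈ derU t V n ⊔ annU t,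
        bkt t x y ∈ derU t V (n + 1) ⊔ annU t := by
      intro x hx y hy
      obtain ⟨v, hv, k, hk, rfl⟩ := Submodule.mem_sup.1 hx
      obtain ⟨w, hw, l, hl, rfl⟩ := Submodule.mem_sup.1 hy
      rw [bkt_add_left, bkt_annU_left hk, add_zero, bkt_add_right]
      exact Submodule.add_mem_sup (mem_bspan hv hw) (bkt_annU_right h1 h2 hl v)
    refine sup_le (sup_le ?_ ?_) ?_ <;> refine tspan_le.2 fun a ha b hb c hc => ?_ <;>
      rw [Submodule.mem_comap, LinearMap.inl_apply, ← bkt_bkt_inl]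
    · exact key _ (hn _ (ih hb) _).2 _ (ih hc)
    · exact key _ (hn _ (ih ha) _).1 _ (ih hc)
    · exact (hn' _ (key _ (ih ha) _ (ih hb)) _).1

lemma IsSolvU.comap_inl (h1 : LTS1 t) (h2 : LTS2 t) {V : Submodule K (T × (T ⊗[K] T))}
    (hV : IsIdealU t V) (hs : IsSolvU t V) :
    IsSolvT t (V.comap (LinearMap.inl K T (T ⊗[K] T))) := by
  obtain ⟨k, hk⟩ := hs
  refine ⟨k, eq_bot_iff.2 ((derT_comap_inl_le h1 h2 hV k).trans ?_)⟩
  rw [hk, bot_sup_eq]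
  exact fun x hx => hx.1

end Solvability

section TripleIdeals

variable {t : T →ₗ[K] T →ₗ[K] T →ₗ[K] T} {I : Submodule K T}

lemma tmul_mem_iI_left {x : T} (hx : x ∈ I) (a : T) : x ⊗ₜ a ∈ iI I :=
  Submodule.subset_span (Or.inl ⟨x, hx, a, rfl⟩)

lemma tmul_mem_iI_right {x : T} (hx : x ∈ I) (a : T) : a ⊗ₜ x ∈ iI I :=
  Submodule.subset_span (Or.inr ⟨x, hx, a, rfl⟩)

lemma iI_le {W : Submodule K (T ⊗[K] T)} :
    iI I ≤ W ↔ ∀ x ∈ I, ∀ a : T, x ⊗ₜ a ∈ W ∧ a ⊗ₜ x ∈ W := by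
  refine ⟨fun h x hx a => ⟨h (tmul_mem_iI_left hx a), h (tmul_mem_iI_right hx a)⟩, fun h => ?_⟩
  rw [iI, Submodule.span_le]
  rintro _ (⟨x, hx, a, rfl⟩ | ⟨x, hx, a, rfl⟩)
  exacts [(h x hx a).1, (h x hx a).2]

lemma IsIdealT.iI_le_jI (hI : IsIdealT t I) : iI I ≤ jI t I := by
  refine iI_le.2 fun x hx a => ?_
  simp only [mem_jI, lift.tmul, rightOp_tmul]
  exact ⟨fun b => ⟨(hI x hx a b).1, sub_mem (hI x hx b a).2.1 (hI x hx b a).2.2⟩,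
    fun b => ⟨(hI x hx a b).2.1, sub_mem (hI x hx b a).2.2 (hI x hx b a).2.1⟩⟩

lemma IsIdealT.rightOp_mem (hI : IsIdealT t I) {x : T} (hx : x ∈ I) (w : T ⊗[K] T) :
    rightOp t w x ∈ I := by
  induction w with
  | zero => simp
  | add v w hv hw => simpa using add_mem hv hw
  | tmul a b => exact sub_mem (hI x hx a b).1 (hI x hx b a).1

lemma IsIdealT.lift_mem (hI : IsIdealT t I) {x : T} (hx : x ∈ I) (w : T ⊗[K] T) :
    lift t w x ∈ I := by
  induction w with
  | zero => simp
  | add v w hv hw => simpa using add_mem hv hw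
  | tmul a b => exact (hI x hx a b).2.2

lemma bktTL_mem_iI_of_mem_jI {w : T ⊗[K] T} (hw : w ∈ jI t I) (u : T ⊗[K] T) :
    bktTL t w u ∈ iI I := by
  induction u with
  | zero => simp
  | add v w hv hw => simpa using add_mem hv hw
  | tmul c d =>
    exact sub_mem (tmul_mem_iI_left (((mem_jI t).1 hw) c).1 d)
      (tmul_mem_iI_left (((mem_jI t).1 hw) d).1 c)

lemma IsIdealT.bkt_mem_IU (hI : IsIdealT t I) {v : T × (T ⊗[K] T)} (hv : v ∈ JU t I)
    (x : T × (T ⊗[K] T)) : bkt t v x ∈ IU I := by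
  obtain ⟨p, w⟩ := v
  obtain ⟨a, u⟩ := x
  obtain ⟨hp : p ∈ I, hw : w ∈ jI t I⟩ := hv
  rw [bkt_mk]
  exact ⟨add_mem (((mem_jI t).1 hw) a).1 (hI.rightOp_mem hp u),
    add_mem (tmul_mem_iI_left hp a) (bktTL_mem_iI_of_mem_jI hw u)⟩

lemma bktTL_mem_iI_sup (h1 : LTS1 t) (h2 : LTS2 t) {w : T ⊗[K] T} (hw : w ∈ jI t I)
    (u : T ⊗[K] T) : bktTL t u w ∈ iI I ⊔ jI t ⊥ := by
  induction u with
  | zero => simp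
  | add v w hv hw => simpa using add_mem hv hw
  | tmul a b =>
    have e : bktTL t (a ⊗ₜ b) w = (a ⊗ₜ rightOp t w b + rightOp t w a ⊗ₜ b)
        - (a ⊗ₜ rightOp t w b - bktTL t (a ⊗ₜ b) w + rightOp t w a ⊗ₜ b) := by abel
    rw [e]
    exact sub_mem (Submodule.mem_sup_left (add_mem (tmul_mem_iI_right (((mem_jI t).1 hw) b).2 a)
      (tmul_mem_iI_left (((mem_jI t).1 hw) a).2 b)))
      (Submodule.mem_sup_right (tmul_rightOp_sub_mem h1 h2 a b w))

lemma IU_sup_annU : IU I ⊔ annU t = I.prod (iI I ⊔ jI t ⊥) := by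
  rw [IU, Submodule.prod_sup_prod, sup_bot_eq]

lemma IsIdealT.bkt_mem_IU_sup (h1 : LTS1 t) (h2 : LTS2 t) (hI : IsIdealT t I)
    {v : T × (T ⊗[K] T)} (hv : v ∈ JU t I) (x : T × (T ⊗[K] T)) :
    bkt t x v ∈ IU I ⊔ annU t := by
  obtain ⟨p, w⟩ := v
  obtain ⟨a, u⟩ := x
  obtain ⟨hp : p ∈ I, hw : w ∈ jI t I⟩ := hv
  rw [bkt_mk, IU_sup_annU]
  exact ⟨add_mem (hI.lift_mem hp u) (((mem_jI t).1 hw) a).2,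
    add_mem (Submodule.mem_sup_left (tmul_mem_iI_right hp a)) (bktTL_mem_iI_sup h1 h2 hw u)⟩

lemma IsIdealT.IU_sup_annU_le_JU (hI : IsIdealT t I) : IU I ⊔ annU t ≤ JU t I := by
  rw [IU_sup_annU]
  refine Submodule.prod_mono le_rfl (sup_le hI.iI_le_jI fun w hw => ?_)
  rw [mem_jI] at hw ⊢
  intro a
  rw [(hw a).1, (hw a).2]
  exact ⟨zero_mem _, zero_mem _⟩

lemma IsIdealT.isIdealU_JU (h1 : LTS1 t) (h2 : LTS2 t) (hI : IsIdealT t I) :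
    IsIdealU t (JU t I) := fun _ hv x =>
  ⟨hI.IU_sup_annU_le_JU (Submodule.mem_sup_left (hI.bkt_mem_IU hv x)),
    hI.IU_sup_annU_le_JU (hI.bkt_mem_IU_sup h1 h2 hv x)⟩

lemma IsIdealT.isIdealU_IU (hI : IsIdealT t I) : IsIdealU t (IU I) := by
  refine fun v hv x =>
    ⟨hI.bkt_mem_IU (hI.IU_sup_annU_le_JU (Submodule.mem_sup_left hv)) x, ?_⟩
  obtain ⟨p, w⟩ := v
  obtain ⟨a, u⟩ := x
  obtain ⟨hp : p ∈ I, hw : w ∈ iI I⟩ := hv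
  rw [bkt_mk]
  refine ⟨add_mem (hI.lift_mem hp u) (((mem_jI t).1 (hI.iI_le_jI hw)) a).2,
    add_mem (tmul_mem_iI_right hp a) ?_⟩
  suffices h : iI I ≤ (iI I).comap (bktTL t u) from h hw
  refine iI_le.2 fun x hx b => ?_
  simp only [Submodule.mem_comap, bktTL_tmul]
  exact ⟨sub_mem (tmul_mem_iI_left (hI.lift_mem hx u) b) (tmul_mem_iI_right hx _),
    sub_mem (tmul_mem_iI_right hx _) (tmul_mem_iI_left (hI.lift_mem hx u) b)⟩

/-- `{T I I} + {I T I} + {I I T}`. -/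
def derivedT (t : T →ₗ[K] T →ₗ[K] T →ₗ[K] T) (I : Submodule K T) : Submodule K T :=
  tspan t ⊤ I I ⊔ tspan t I ⊤ I ⊔ tspan t I I ⊤

lemma derivedT_le {J : Submodule K T} :
    derivedT t I ≤ J ↔
      ∀ x ∈ I, ∀ y ∈ I, ∀ a : T, t a x y ∈ J ∧ t x a y ∈ J ∧ t x y a ∈ J := by
  simp only [derivedT, sup_le_iff, tspan_le]
  exact ⟨fun h x hx y hy a => ⟨h.1.1 a trivial x hx y hy, h.1.2 x hx a trivial y hy,
    h.2 x hx y hy a trivial⟩, fun h => ⟨⟨fun a _ x hx y hy => (h x hx y hy a).1,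
    fun x hx a _ y hy => (h x hx y hy a).2.1⟩, fun x hx y hy a _ => (h x hx y hy a).2.2⟩⟩

lemma mem_derivedT {x y : T} (hx : x ∈ I) (hy : y ∈ I) (a : T) :
    t a x y ∈ derivedT t I ∧ t x a y ∈ derivedT t I ∧ t x y a ∈ derivedT t I :=
  derivedT_le.1 le_rfl x hx y hy a

lemma IsIdealT.derivedT (h1 : LTS1 t) (h2 : LTS2 t) (hI : IsIdealT t I) :
    IsIdealT t (derivedT t I) := by
  have m₁ {x y : T} (hx : x ∈ I) (hy : y ∈ I) (a : T) := (mem_derivedT (t := t) hx hy a).1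
  have m₂ {x y : T} (hx : x ∈ I) (hy : y ∈ I) (a : T) := (mem_derivedT (t := t) hx hy a).2.1
  have m₃ {x y : T} (hx : x ∈ I) (hy : y ∈ I) (a : T) := (mem_derivedT (t := t) hx hy a).2.2
  have i₁ {x : T} (hx : x ∈ I) (a b : T) := (hI x hx a b).1
  have i₂ {x : T} (hx : x ∈ I) (a b : T) := (hI x hx a b).2.1
  have i₃ {x : T} (hx : x ∈ I) (a b : T) := (hI x hx a b).2.2
  have aux (a b c d e : T) : t (t a b c) d e =
      t a b (t c d e) + t (t a b d) c e + t (t a b e) c d - t (t a b e) d c := by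
    rw [h2 a b c d e]; abel
  have aux' (a b c d e : T) : t (t a b c) d e =
      t a (t b c d) e + t (t a c b) d e + t (t a d b) c e - t (t a d c) b e := by
    rw [h1 a b c d e]; abel
  have l₁ : ∀ x ∈ I, ∀ y ∈ I, ∀ a d e : T, t (t a x y) d e ∈ _root_.derivedT t I := by
    intro x hx y hy a d e
    rw [aux]
    exact sub_mem (add_mem (add_mem (m₁ hx (i₁ hy _ _) _) (m₃ (i₂ hx _ _) hy _))
      (m₃ (i₂ hx _ _) hy _)) (m₂ (i₂ hx _ _) hy _)
  have l₂ : ∀ x ∈ I, ∀ y ∈ I, ∀ a d e : T, t (t x a y) d e ∈ _root_.derivedT t I := by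
    intro x hx y hy a d e
    rw [aux]
    exact sub_mem (add_mem (add_mem (m₂ hx (i₁ hy _ _) _) (m₃ (i₁ hx _ _) hy _))
      (m₃ (i₁ hx _ _) hy _)) (m₂ (i₁ hx _ _) hy _)
  have l₃ : ∀ x ∈ I, ∀ y ∈ I, ∀ a d e : T, t (t x y a) d e ∈ _root_.derivedT t I := by
    intro x hx y hy a d e
    rw [aux']
    exact sub_mem (add_mem (add_mem (m₃ hx (i₁ hy _ _) _) (l₂ x hx y hy _ _ _))
      (l₂ x hx y hy _ _ _)) (m₃ (i₁ hx _ _) hy _)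
  intro z hz a b
  refine ⟨?_, ?_, ?_⟩
  · suffices h : _root_.derivedT t I ≤ (_root_.derivedT t I).comap ((t.flip a).flip b) from h hz
    exact derivedT_le.2 fun x hx y hy c =>
      ⟨l₁ x hx y hy c a b, l₂ x hx y hy c a b, l₃ x hx y hy c a b⟩
  · suffices h : _root_.derivedT t I ≤ (_root_.derivedT t I).comap ((t a).flip b) from h hz
    refine derivedT_le.2 fun x hx y hy c => ?_
    simp only [Submodule.mem_comap, LinearMap.flip_apply]
    rw [h1 a c x y, h1 a x c y, h1 a x y c]
    refine ⟨?_, ?_, ?_⟩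
    · exact add_mem (sub_mem (sub_mem (m₃ (i₃ hx _ _) hy _) (m₃ (i₂ hx _ _) hy _))
        (m₃ (i₂ hy _ _) hx _)) (l₁ y hy x hx _ _ _)
    · exact add_mem (sub_mem (sub_mem (m₃ (i₂ hx _ _) hy _) (m₃ (i₃ hx _ _) hy _))
        (l₁ y hy x hx _ _ _)) (m₃ (i₂ hy _ _) hx _)
    · exact add_mem (sub_mem (sub_mem (l₁ x hx y hy _ _ _) (l₁ y hy x hx _ _ _))
        (m₃ (i₃ hx _ _) hy _)) (m₃ (i₃ hy _ _) hx _)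
  · suffices h : _root_.derivedT t I ≤ (_root_.derivedT t I).comap (t a b) from h hz
    refine derivedT_le.2 fun x hx y hy c => ?_
    simp only [Submodule.mem_comap]
    rw [h2 a b c x y, h2 a b x c y, h2 a b x y c]
    refine ⟨?_, ?_, ?_⟩
    · exact add_mem (sub_mem (sub_mem (m₁ hx hy _) (m₂ (i₃ hx _ _) hy _))
        (m₂ (i₃ hy _ _) hx _)) (m₃ (i₃ hy _ _) hx _)
    · exact add_mem (sub_mem (sub_mem (m₂ (i₃ hx _ _) hy _) (m₁ hx hy _))
        (m₃ (i₃ hy _ _) hx _)) (m₂ (i₃ hy _ _) hx _)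
    · exact add_mem (sub_mem (sub_mem (m₃ (i₃ hx _ _) hy _) (m₃ (i₃ hy _ _) hx _))
        (m₁ hx hy _)) (m₁ hy hx _)

lemma IsIdealT.derT (h1 : LTS1 t) (h2 : LTS2 t) (hI : IsIdealT t I) (n : ℕ) :
    IsIdealT t (derT t I n) := by
  induction n with
  | zero => exact hI
  | succ n ih => exact ih.derivedT h1 h2

/-- The image of `I ⊗ I` in `T ⊗ T`, as a subspace of `U(T)`. -/
def sqU (I : Submodule K T) : Submodule K (T × (T ⊗[K] T)) :=
  (⊥ : Submodule K T).prod (Submodule.map₂ (TensorProduct.mk K T T) I I)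

lemma IsIdealT.bspan_IU_le (hI : IsIdealT t I) :
    bspan t (IU I) (IU I) ≤ IU (_root_.derivedT t I) ⊔ sqU I := by
  refine bspan_le.2 fun v hv v' hv' => ?_
  obtain ⟨p, w⟩ := v
  obtain ⟨q, u⟩ := v'
  obtain ⟨hp : p ∈ I, hw : w ∈ iI I⟩ := hv
  obtain ⟨hq : q ∈ I, hu : u ∈ iI I⟩ := hv'
  have hl {x : T} (hx : x ∈ I) : lift t w x ∈ _root_.derivedT t I := by
    suffices h : iI I ≤ (_root_.derivedT t I).comap ((lift t).flip x) from h hw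
    exact iI_le.2 fun y hy a => ⟨(mem_derivedT hy hx a).2.1, (mem_derivedT hy hx a).1⟩
  rw [bkt_mk, IU, sqU, Submodule.prod_sup_prod, sup_bot_eq]
  refine ⟨add_mem (hl hq) ?_,
    add_mem (Submodule.mem_sup_right (Submodule.apply_mem_map₂ _ hp hq)) ?_⟩
  · suffices h : iI I ≤ (_root_.derivedT t I).comap ((rightOp t).flip p) from h hu
    refine iI_le.2 fun y hy a => ?_
    simp only [Submodule.mem_comap, LinearMap.flip_apply, rightOp_tmul]
    have h := mem_derivedT (t := t) hp hy a
    exact ⟨sub_mem h.2.2 h.2.1, sub_mem h.2.1 h.2.2⟩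
  · suffices h : iI I ≤ (iI (_root_.derivedT t I) ⊔
        Submodule.map₂ (TensorProduct.mk K T T) I I).comap (bktTL t w) from h hu
    refine iI_le.2 fun y hy a => ?_
    simp only [Submodule.mem_comap, bktTL_tmul]
    have h : lift t w y ⊗ₜ a ∈ iI (_root_.derivedT t I) ⊔
        Submodule.map₂ (TensorProduct.mk K T T) I I :=
      Submodule.mem_sup_left (tmul_mem_iI_left (hl hy) a)
    have h' : lift t w a ⊗ₜ y ∈ iI (_root_.derivedT t I) ⊔
        Submodule.map₂ (TensorProduct.mk K T T) I I :=
      Submodule.mem_sup_right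
        (Submodule.apply_mem_map₂ _ (((mem_jI t).1 (hI.iI_le_jI hw)) a).1 hy)
    exact ⟨sub_mem h h', sub_mem h' h⟩

lemma bspan_sqU_le : bspan t (sqU I) (sqU I) ≤ IU (derivedT t I) := by
  refine bspan_le.2 fun v hv v' hv' => ?_
  obtain ⟨p, w⟩ := v
  obtain ⟨q, u⟩ := v'
  obtain ⟨rfl : p = 0, hw : w ∈ Submodule.map₂ (TensorProduct.mk K T T) I I⟩ := hv
  obtain ⟨rfl : q = 0, hu : u ∈ Submodule.map₂ (TensorProduct.mk K T T) I I⟩ := hv'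
  have hl {x : T} (hx : x ∈ I) : lift t w x ∈ derivedT t I := by
    suffices h : Submodule.map₂ (TensorProduct.mk K T T) I I ≤
      (derivedT t I).comap ((lift t).flip x) from h hw
    exact Submodule.map₂_le.2 fun y hy z _ => (mem_derivedT hy hx z).2.1
  rw [bkt_mk]
  simp only [map_zero, zero_tmul, add_zero, zero_add]
  refine ⟨zero_mem _, ?_⟩
  suffices h : Submodule.map₂ (TensorProduct.mk K T T) I I ≤
      (iI (derivedT t I)).comap (bktTL t w) from h hu
  exact Submodule.map₂_le.2 fun y hy z hz =>
    sub_mem (tmul_mem_iI_left (hl hy) z) (tmul_mem_iI_left (hl hz) y)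

lemma IsIdealT.bspan_bspan_IU_le (h1 : LTS1 t) (h2 : LTS2 t) (hI : IsIdealT t I) :
    bspan t (bspan t (IU I) (IU I)) (bspan t (IU I) (IU I)) ≤ IU (_root_.derivedT t I) := by
  have hD := (hI.derivedT h1 h2).isIdealU_IU
  refine (bspan_mono hI.bspan_IU_le hI.bspan_IU_le).trans (bspan_le.2 fun x hx y hy => ?_)
  obtain ⟨a, ha, b, hb, rfl⟩ := Submodule.mem_sup.1 hx
  obtain ⟨c, hc, d, hd, rfl⟩ := Submodule.mem_sup.1 hy
  rw [bkt_add_left, bkt_add_right b]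
  exact add_mem (hD a ha _).1 (add_mem (hD c hc b).2 (bspan_sqU_le (mem_bspan hb hd)))

lemma IsIdealT.isSolvU_IU (h1 : LTS1 t) (h2 : LTS2 t) (hI : IsIdealT t I) (hs : IsSolvT t I) :
    IsSolvU t (IU I) := by
  have key (n : ℕ) : derU t (IU I) (2 * n) ≤ IU (_root_.derT t I n) := by
    induction n with
    | zero => exact le_rfl
    | succ n ih =>
      exact (bspan_mono (bspan_mono ih ih) (bspan_mono ih ih)).trans
        ((hI.derT h1 h2 n).bspan_bspan_IU_le h1 h2)
  obtain ⟨k, hk⟩ := hs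
  refine ⟨2 * k, eq_bot_iff.2 ((key k).trans ?_)⟩
  rw [hk, IU, ← Submodule.prod_bot]
  refine Submodule.prod_mono le_rfl (iI_le.2 ?_)
  rintro x (rfl : x = 0) a
  simp

lemma IsIdealT.isSolvU_JU (h1 : LTS1 t) (h2 : LTS2 t) (hI : IsIdealT t I) (hs : IsSolvT t I) :
    IsSolvU t (JU t I) :=
  (hI.isSolvU_IU h1 h2 hs).of_derU_le 1 (bspan_le.2 fun _ hv x _ => hI.bkt_mem_IU hv x)

end TripleIdeals

section Radical

variable {t : T →ₗ[K] T →ₗ[K] T →ₗ[K] T}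

lemma comap_inl_radU [FiniteDimensional K T] (h1 : LTS1 t) (h2 : LTS2 t) :
    Submodule.comap (LinearMap.inl K T (T ⊗[K] T)) (radU t) = radT t := by
  obtain ⟨hi, hs⟩ := radU_mem (t := t)
  refine le_antisymm (le_radT hi.comap_inl (hs.comap_inl h1 h2 hi)) (sSup_le ?_)
  rintro I ⟨hI, hI'⟩ x hx
  exact le_radU hI.isIdealU_IU (hI.isSolvU_IU h1 h2 hI') ⟨hx, zero_mem _⟩

lemma radT_mem [FiniteDimensional K T] (h1 : LTS1 t) (h2 : LTS2 t) :
    IsIdealT t (radT t) ∧ IsSolvT t (radT t) := by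
  obtain ⟨hi, hs⟩ := radU_mem (t := t)
  rw [← comap_inl_radU h1 h2]
  exact ⟨hi.comap_inl, hs.comap_inl h1 h2 hi⟩

/-- The parity map `(a, w) ↦ (-a, w)` of `U(T)`. -/
def parity : (T × (T ⊗[K] T)) →ₗ[K] (T × (T ⊗[K] T)) :=
  LinearMap.prodMap (-LinearMap.id) LinearMap.id

@[simp] lemma parity_mk (a : T) (w : T ⊗[K] T) : parity (K := K) (a, w) = (-a, w) := rfl

lemma parity_parity (x : T × (T ⊗[K] T)) : parity (parity x) = x := by
  obtain ⟨a, w⟩ := x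
  simp

lemma parity_bkt (x y : T × (T ⊗[K] T)) : parity (bkt t x y) = bkt t (parity x) (parity y) := by
  obtain ⟨a, w⟩ := x
  obtain ⟨b, v⟩ := y
  simp only [bkt_mk, parity_mk, map_neg, neg_tmul, tmul_neg, neg_neg, neg_add]

lemma comap_parity_radU_le [FiniteDimensional K T] : (radU t).comap parity ≤ radU t := by
  obtain ⟨hi, k, hk⟩ := radU_mem (t := t)
  refine le_radU (fun v hv x => ?_) ⟨k, ?_⟩
  · simp only [Submodule.mem_comap, parity_bkt]
    exact hi _ hv _
  · have key (n : ℕ) : derU t ((radU t).comap parity) n ≤ (derU t (radU t) n).comap parity := by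
      induction n with
      | zero => exact le_rfl
      | succ n ih =>
        refine bspan_le.2 fun x hx y hy => ?_
        rw [Submodule.mem_comap, parity_bkt]
        exact mem_bspan (ih hx) (ih hy)
    refine eq_bot_iff.2 ((key k).trans ?_)
    rw [hk]
    intro x (hx : parity x = 0)
    rw [Submodule.mem_bot, ← parity_parity x, hx, map_zero]

lemma radU_eq_JU [FiniteDimensional K T] (h1 : LTS1 t) (h2 : LTS2 t) :
    radU t = JU t (radT t) := by
  obtain ⟨hi, hs⟩ := radT_mem h1 h2
  refine le_antisymm ?_ (le_radU (hi.isIdealU_JU h1 h2) (hi.isSolvU_JU h1 h2 hs))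
  rintro ⟨a, w⟩ hx
  have hinl {a : T} : a ∈ radT t ↔ (a, (0 : T ⊗[K] T)) ∈ radU t := by
    rw [← comap_inl_radU h1 h2]; rfl
  have hp : (-a, w) ∈ radU t := comap_parity_radU_le (by
    rw [Submodule.mem_comap, parity_mk, neg_neg]
    exact hx)
  have ha : (a, (0 : T ⊗[K] T)) ∈ radU t := by
    have e : (a, (0 : T ⊗[K] T)) = (2⁻¹ : K) • ((a, w) - (-a, w)) := by
      ext
      · simp [← two_smul K a]
      · simp
    rw [e]
    exact Submodule.smul_mem _ _ (sub_mem hx hp)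
  have hw : ((0 : T), w) ∈ radU t := by
    have e : ((0 : T), w) = (a, w) - (a, 0) := by simp
    rw [e]
    exact sub_mem hx ha
  refine ⟨hinl.2 ha, (mem_jI t).2 fun b => ?_⟩
  have := radU_mem.1 _ hw (b, 0)
  simp only [bkt_mk] at this
  simpa [hinl] using this

/-- The squares `[x, x]` of `U(T)` lie in its solvable radical. -/
lemma bkt_self_mem_radU (h1 : LTS1 t) (h2 : LTS2 t)
    (x : T × (T ⊗[K] T)) : bkt t x x ∈ radU t := by
  have hmem (x) : bkt t x x ∈ kerU t := Submodule.subset_span ⟨x, rfl⟩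
  have hpol (x y) : bkt t x y + bkt t y x ∈ kerU t := by
    have := sub_mem (sub_mem (hmem (x + y)) (hmem x)) (hmem y)
    rw [bkt_add_left, bkt_add_right, bkt_add_right] at this
    convert! this using 1
    abel
  have hright (x z) (hz : z ∈ kerU t ⊔ annU t) : bkt t x z ∈ annU t := by
    suffices h : kerU t ⊔ annU t ≤ (annU t).comap (bktL t x) from h hz
    refine sup_le (Submodule.span_le.2 ?_) fun k hk => bkt_annU_right h1 h2 hk x
    rintro _ ⟨y, rfl⟩
    have := bkt_leibniz_mem h1 h2 x y y
    rwa [sub_add_cancel] at this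
  have hleft (x z) (hz : z ∈ kerU t ⊔ annU t) : bkt t z x ∈ kerU t ⊔ annU t := by
    suffices h : kerU t ⊔ annU t ≤ (kerU t ⊔ annU t).comap ((bktL t).flip x) from h hz
    refine sup_le (Submodule.span_le.2 ?_) fun k hk => ?_
    · rintro _ ⟨y, rfl⟩
      have e : bkt t (bkt t y y) x = (bkt t y (bkt t y x) + bkt t (bkt t y x) y)
        - (bkt t y (bkt t y x) - bkt t (bkt t y y) x + bkt t (bkt t y x) y) := by abel
      change bkt t (bkt t y y) x ∈ kerU t ⊔ annU t
      rw [e]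
      exact sub_mem (Submodule.mem_sup_left (hpol y _))
        (Submodule.mem_sup_right (bkt_leibniz_mem h1 h2 y y x))
    · change bkt t k x ∈ kerU t ⊔ annU t
      rw [bkt_annU_left hk]
      exact zero_mem _
  refine le_radU (V := kerU t ⊔ annU t)
    (fun v hv x => ⟨hleft x v hv, Submodule.mem_sup_right (hright x v hv)⟩)
    (isSolvU_annU.of_derU_le 1 (bspan_le.2 fun x _ y hy => hright x y hy))
    (Submodule.mem_sup_left (hmem x))

end Radical

section Whitehead

/-- A bilinear form on a Killing Lie algebra whose flip is a `1`-cocycle with values in the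
coadjoint module is a coboundary. -/
lemma LieAlgebra.IsKilling.exists_dual_of_cocycle {k L : Type*} [Field k] [LieRing L]
    [LieAlgebra k L] [Module.Finite k L] [LieAlgebra.IsKilling k L] (f : L →ₗ[k] L →ₗ[k] k)
    (hf : ∀ x y z, f x ⁅y, z⁆ = f ⁅x, y⁆ z - f ⁅x, z⁆ y) :
    ∃ h : L →ₗ[k] k, ∀ x y, f x y = h ⁅x, y⁆ := by
  have hnd := LieAlgebra.IsKilling.killingForm_nondegenerate k L
  let e := LinearMap.BilinForm.toDual (killingForm k L) hnd
  let D₀ : L →ₗ[k] L := e.symm.toLinearMap ∘ₗ f.flip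
  have hD (x y : L) : killingForm k L (D₀ y) x = f x y :=
    LinearMap.congr_fun (e.apply_symm_apply (f.flip y)) x
  have hinj {a b : L} (h : ∀ x, killingForm k L a x = killingForm k L b x) : a = b :=
    e.injective (LinearMap.ext h)
  let D : LieDerivation k L L :=
    { D₀ with
      leibniz' := fun y z => hinj fun x => by
        change killingForm k L (D₀ ⁅y, z⁆) x = killingForm k L (⁅y, D₀ z⁆ - ⁅z, D₀ y⁆) x
        rw [hD, hf, map_sub, LinearMap.sub_apply, LieModule.traceForm_apply_lie_apply',
          LieModule.traceForm_apply_lie_apply', hD, hD, ← lie_skew x y, ← lie_skew x z]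
        simp only [map_neg, LinearMap.neg_apply] }
  obtain ⟨u, hu⟩ := LieDerivation.IsKilling.exists_eq_ad D
  refine ⟨-killingForm k L u, fun x y => ?_⟩
  have hu' : D₀ y = ⁅u, y⁆ := by
    change D y = _
    rw [← hu]
    exact LinearMap.congr_fun (LieDerivation.coe_ad_apply_eq_ad_apply u) y
  rw [← hD, hu', LieModule.traceForm_apply_lie_apply, ← lie_skew y x]
  simp only [map_neg, LinearMap.neg_apply]

/-- Let `P` be an ideal of a bilinear algebra such that the quotient by `P` is a Lie algebra
without nonzero abelian ideals. A linear form whose composition with the bracket descends to a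
Leibniz cocycle on the quotient agrees on all brackets with a linear form vanishing on `P`. -/
lemma exists_dual_eq_on_bracket {k L : Type*} [Field k] [CharZero k] [AddCommGroup L] [Module k L]
    [FiniteDimensional k L] (b : L →ₗ[k] L →ₗ[k] L) (P : Submodule k L)
    (hl : ∀ p ∈ P, ∀ x, b p x ∈ P) (hr : ∀ p ∈ P, ∀ x, b x p ∈ P) (hself : ∀ x, b x x ∈ P)
    (hleib : ∀ x y z, b x (b y z) - b (b x y) z + b (b x z) y ∈ P)
    (hrad : ∀ V : Submodule k L, (∀ v ∈ V, ∀ x, b x v ∈ V ∧ b v x ∈ V) →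
      (∀ v ∈ V, ∀ w ∈ V, b v w ∈ P) → V ≤ P)
    (φ : L →ₗ[k] k) (hφl : ∀ p ∈ P, ∀ x, φ (b p x) = 0) (hφr : ∀ p ∈ P, ∀ x, φ (b x p) = 0)
    (hφ : ∀ x y z, φ (b x (b y z) - b (b x y) z + b (b x z) y) = 0) :
    ∃ h : L →ₗ[k] k, (∀ p ∈ P, h p = 0) ∧ ∀ x y, φ (b x y) = h (b x y) := by
  let br : (L ⧸ P) →ₗ[k] (L ⧸ P) →ₗ[k] (L ⧸ P) :=
    P.liftQ ((P.liftQ (b.compr₂ P.mkQ).flip fun p hp => by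
      ext x; exact (Submodule.Quotient.mk_eq_zero P).2 (hr p hp x)).flip) fun p hp => by
        ext x; exact (Submodule.Quotient.mk_eq_zero P).2 (hl p hp x)
  have hbr (x y : L) : br (P.mkQ x) (P.mkQ y) = P.mkQ (b x y) := rfl
  have hmk {x y : L} (h : x - y ∈ P) : P.mkQ x = P.mkQ y := (Submodule.Quotient.eq P).2 h
  have hskew (x y : L) : b x y + b y x ∈ P := by
    have := sub_mem (sub_mem (hself (x + y)) (hself x)) (hself y)
    simp only [map_add, LinearMap.add_apply] at this
    convert! this using 1
    abel
  have hsurj := P.mkQ_surjective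
  let _ : LieRing (L ⧸ P) :=
    { bracket := fun x y => br x y
      add_lie := fun x y z => LinearMap.map_add₂ br x y z
      lie_add := fun x y z => map_add (br x) y z
      lie_self := fun x => by
        obtain ⟨x, rfl⟩ := hsurj x
        exact (Submodule.Quotient.mk_eq_zero P).2 (hself x)
      leibniz_lie := fun x y z => by
        obtain ⟨x, rfl⟩ := hsurj x
        obtain ⟨y, rfl⟩ := hsurj y
        obtain ⟨z, rfl⟩ := hsurj z
        change br _ (br _ _) = br (br _ _) _ + br _ (br _ _)
        rw [hbr, hbr, hbr, hbr, hbr, hbr, ← map_add]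
        refine hmk ?_
        have e : b x (b y z) - (b (b x y) z + b y (b x z)) =
            (b x (b y z) - b (b x y) z + b (b x z) y) - (b (b x z) y + b y (b x z)) := by abel
        rw [e]
        exact sub_mem (hleib x y z) (hskew _ _) }
  let _ : LieAlgebra k (L ⧸ P) := { lie_smul := fun c x y => map_smul (br x) c y }
  have hlie (x y : L) : ⁅P.mkQ x, P.mkQ y⁆ = P.mkQ (b x y) := rfl
  have : LieAlgebra.HasTrivialRadical k (L ⧸ P) := by
    rw [LieAlgebra.hasTrivialRadical_iff_no_abelian_ideals]
    intro I hI
    have hV := hrad (I.toSubmodule.comap P.mkQ)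
      (fun v hv x => ⟨lie_mem_right k _ I (P.mkQ x) _ hv, lie_mem_left k _ I _ (P.mkQ x) hv⟩)
      (fun v hv w hw => (Submodule.Quotient.mk_eq_zero P).1
        (congrArg Subtype.val (hI.trivial ⟨P.mkQ v, hv⟩ ⟨P.mkQ w, hw⟩)))
    rw [LieSubmodule.eq_bot_iff]
    intro x hx
    obtain ⟨x, rfl⟩ := hsurj x
    exact (Submodule.Quotient.mk_eq_zero P).2 (hV hx)
  let f : (L ⧸ P) →ₗ[k] (L ⧸ P) →ₗ[k] k :=
    P.liftQ ((P.liftQ (b.compr₂ φ).flip fun p hp => by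
      ext x; exact hφr p hp x).flip) fun p hp => by ext x; exact hφl p hp x
  have hf (x y : L) : f (P.mkQ x) (P.mkQ y) = φ (b x y) := rfl
  obtain ⟨h, hh⟩ := LieAlgebra.IsKilling.exists_dual_of_cocycle f (by
    intro x y z
    obtain ⟨x, rfl⟩ := hsurj x
    obtain ⟨y, rfl⟩ := hsurj y
    obtain ⟨z, rfl⟩ := hsurj z
    rw [hlie, hlie, hlie, hf, hf, hf]
    have := hφ x y z
    simp only [map_add, map_sub] at this
    linear_combination this)
  refine ⟨h ∘ₗ P.mkQ, fun p hp => ?_, fun x y => ?_⟩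
  · rw [LinearMap.comp_apply, show P.mkQ p = 0 from (Submodule.Quotient.mk_eq_zero P).2 hp, map_zero]
  · rw [← hf, hh, hlie, LinearMap.comp_apply]

end Whitehead

lemma JU_radT_le [FiniteDimensional K T] {t : T →ₗ[K] T →ₗ[K] T →ₗ[K] T} (h1 : LTS1 t)
    (h2 : LTS2 t) : JU t (radT t) ≤ IU (radT t) ⊔ annU t := by
  have hR := (radT_mem h1 h2).1
  obtain ⟨hrad, hsolv⟩ := radU_mem (t := t)
  have hJ := radU_eq_JU h1 h2
  rintro ⟨p, w⟩ hpw
  by_contra hmem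
  obtain ⟨φ, hφ, hker⟩ := Submodule.exists_le_ker_of_notMem hmem
  have hann {x} (hx : x ∈ annU t) : φ x = 0 := hker (Submodule.mem_sup_right hx)
  obtain ⟨h, hP, hh⟩ := exists_dual_eq_on_bracket (bktL t) (radU t)
    (fun v hv x => (hrad v hv x).1) (fun v hv x => (hrad v hv x).2)
    (fun x => bkt_self_mem_radU h1 h2 x)
    (fun x y z => hJ ▸ hR.IU_sup_annU_le_JU
      (Submodule.mem_sup_right (bkt_leibniz_mem h1 h2 x y z)))
    (fun V hV hab => le_radU (fun v hv x => (hV v hv x).symm)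
      (hsolv.of_derU_le 1 (bspan_le.2 hab)))
    φ (fun v hv x => hker (Submodule.mem_sup_left (hR.bkt_mem_IU (hJ ▸ hv) x)))
    (fun v hv x => hker (hR.bkt_mem_IU_sup h1 h2 (hJ ▸ hv) x))
    (fun x y z => hann (bkt_leibniz_mem h1 h2 x y z))
  have heven (u : T ⊗[K] T) : φ (0, u) = h (0, u) := by
    suffices e : φ ∘ₗ LinearMap.inr K T (T ⊗[K] T) = h ∘ₗ LinearMap.inr K T (T ⊗[K] T) from
      LinearMap.congr_fun e u
    refine TensorProduct.ext' fun a b => ?_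
    have := hh (a, 0) (b, 0)
    simpa [bktL_apply, bkt_mk] using this
  have hp : φ (p, 0) = 0 := hker (Submodule.mem_sup_left ⟨hpw.1, zero_mem _⟩)
  have hw : φ (0, w) = 0 := by
    rw [heven]
    refine hP _ ?_
    rw [hJ]
    exact ⟨zero_mem _, hpw.2⟩
  apply hφ
  have e : (p, w) = (p, 0) + (0, w) := by simp
  rw [e, map_add, hp, hw, add_zero]


/-- `R(T) = Rad(U(T)) ∩ T` and `Rad(U(T)) = 𝕀(R(T)) + K(T) = 𝕁(R(T))`,
where `K(T) = j(0)`. -/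
theorem radical_of_envelope
    [FiniteDimensional K T]
    (t : T →ₗ[K] T →ₗ[K] T →ₗ[K] T) (h1 : LTS1 t) (h2 : LTS2 t) :
    Submodule.comap (LinearMap.inl K T (T ⊗[K] T)) (radU t) = radT t ∧
    radU t = IU (radT t) ⊔ (⊥ : Submodule K T).prod (jI t ⊥) ∧
    radU t = JU t (radT t) := by
  have hJ := radU_eq_JU h1 h2
  refine ⟨comap_inl_radU h1 h2, ?_, hJ⟩
  rw [hJ]
  exact le_antisymm (JU_radT_le h1 h2) (radT_mem h1 h2).1.IU_sup_annU_le_JU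

end
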